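/- arXiv:1512.02989 — 3 statements merged into one kernel-verified Lean document; each statement's English description precedes it below -/
import Mathlib

section
/- Let (Ω, μ) be a probability space, (S_k)_{k∈ℕ} and (A_k)_{k∈ℕ} sequences of nonnegative integrable random variables, and (r_k)_{k∈ℕ} a sequence of nonnegative reals. Define the virtual queue pathwise by Y_0(ω) = 0 and Y_{k+1}(ω) = max(Y_k(ω) + S_k(ω) − A_k(ω)·r_k, 0). If the virtual queue is mean rate stable, i.e. lim_{K→∞} E[Y_K]/K = 0, and liminf_{K→∞} (1/K)·∑_{k<K} E[A_k] > 0, then limsup_{K→∞} (∑_{k<K} E[S_k]) / (∑_{k<K} E[A_k]) ≤ limsup_{K→∞} (∑_{k<K} r_k·E[A_k]) / (∑_{k<K} E[A_k]). -/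
open MeasureTheory Filter

/-- The queue driven by integrable increments is integrable, and its mean dominates the total mean
increment. -/
lemma integrable_and_sum_integral_le_of_max_rec {Ω : Type*} [MeasurableSpace Ω] {μ : Measure Ω}
    {X Y : ℕ → Ω → ℝ} (hX : ∀ k, Integrable (X k) μ) (hY0 : ∀ ω, Y 0 ω = 0)
    (hYrec : ∀ k ω, Y (k + 1) ω = max (Y k ω + X k ω) 0) (K : ℕ) :
    Integrable (Y K) μ ∧ ∑ k ∈ Finset.range K, ∫ ω, X k ω ∂μ ≤ ∫ ω, Y K ω ∂μ := by
  induction K with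
  | zero => simp [funext hY0]
  | succ K ih =>
    obtain ⟨hint, hle⟩ := ih
    have hadd : Integrable (fun ω => Y K ω + X K ω) μ := hint.add (hX K)
    have hsucc : Integrable (Y (K + 1)) μ := by
      rw [funext (hYrec K)]
      exact hadd.pos_part
    refine ⟨hsucc, ?_⟩
    have hmono : ∫ ω, Y K ω + X K ω ∂μ ≤ ∫ ω, Y (K + 1) ω ∂μ :=
      integral_mono hadd hsucc fun ω => (hYrec K ω).symm ▸ le_max_left _ _
    rw [integral_add hint (hX K)] at hmono
    rw [Finset.sum_range_succ]
    linarith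

/-- A nonnegative sequence with positive lower limit is eventually bounded below by
a positive constant. -/
lemma exists_pos_eventually_le_of_liminf_pos {f : ℕ → ℝ} (hf : ∀ n, 0 ≤ f n)
    (h : 0 < liminf f atTop) : ∃ c > 0, ∀ᶠ n in atTop, c ≤ f n := by
  rw [liminf_eq] at h
  obtain ⟨c, hc, hpos⟩ := exists_lt_of_lt_csSup (by exact ⟨0, Eventually.of_forall hf⟩) h
  exact ⟨c, hpos, hc⟩

/-- Adding a real sequence that tends to zero does not increase the upper limit. -/
lemma EReal.limsup_coe_le_of_eventually_le_add {u v e : ℕ → ℝ} (he : Tendsto e atTop (nhds 0))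
    (h : ∀ᶠ n in atTop, u n ≤ v n + e n) :
    limsup (fun n => (u n : EReal)) atTop ≤ limsup (fun n => (v n : EReal)) atTop := by
  have hlim : limsup (fun n => (e n : EReal)) atTop = 0 :=
    (continuous_coe_real_ereal.continuousAt.tendsto.comp he).limsup_eq
  calc limsup (fun n => (u n : EReal)) atTop
      ≤ limsup ((fun n => (v n : EReal)) + fun n => (e n : EReal)) atTop :=
        limsup_le_limsup (h.mono fun n hn => by
          simpa only [Pi.add_apply, ← EReal.coe_add, EReal.coe_le_coe_iff] using hn)
    _ ≤ limsup (fun n => (v n : EReal)) atTop + limsup (fun n => (e n : EReal)) atTop :=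
        EReal.limsup_add_le (by simp [hlim]) (by simp [hlim])
    _ = limsup (fun n => (v n : EReal)) atTop := by rw [hlim, add_zero]

/-- Inequality (9) of the paper: mean rate stability of the virtual queue
`Y₀ = 0`, `Y_{k+1}(ω) = max (Y_k(ω) + S_k(ω) − A_k(ω)·r_k) 0` together with a
positive long-run average arrival rate implies
`limsup (∑ E[S_k]) / (∑ E[A_k]) ≤ limsup (∑ r_k·E[A_k]) / (∑ E[A_k])`. -/
theorem mean_rate_stable_implies_avg_delay_le_avg_aux
    {Ω : Type*} [MeasurableSpace Ω] (μ : Measure Ω) [IsProbabilityMeasure μ]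
    (S A : ℕ → Ω → ℝ)
    (hSnn : ∀ k ω, 0 ≤ S k ω) (hAnn : ∀ k ω, 0 ≤ A k ω)
    (hSint : ∀ k, Integrable (S k) μ) (hAint : ∀ k, Integrable (A k) μ)
    (r : ℕ → ℝ) (hr : ∀ k, 0 ≤ r k)
    (Y : ℕ → Ω → ℝ)
    (hY0 : ∀ ω, Y 0 ω = 0)
    (hYrec : ∀ k ω, Y (k + 1) ω = max (Y k ω + S k ω - A k ω * r k) 0)
    (hmrs : Tendsto (fun K : ℕ => (∫ ω, Y K ω ∂μ) / (K : ℝ)) atTop (nhds 0))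
    (harr : 0 < liminf
      (fun K : ℕ => (∑ k ∈ Finset.range K, ∫ ω, A k ω ∂μ) / (K : ℝ)) atTop) :
    limsup
      (fun K : ℕ =>
        (((∑ k ∈ Finset.range K, ∫ ω, S k ω ∂μ) /
          (∑ k ∈ Finset.range K, ∫ ω, A k ω ∂μ) : ℝ) : EReal)) atTop ≤
    limsup
      (fun K : ℕ =>
        (((∑ k ∈ Finset.range K, r k * ∫ ω, A k ω ∂μ) /
          (∑ k ∈ Finset.range K, ∫ ω, A k ω ∂μ) : ℝ) : EReal)) atTop := by
  have hqueue := integrable_and_sum_integral_le_of_max_rec (X := fun k ω => S k ω - A k ω * r k)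
    (fun k => (hSint k).sub ((hAint k).mul_const (r k))) hY0
    (fun k ω => by rw [hYrec, add_sub_assoc])
  have hdrift : ∀ K, ∑ k ∈ Finset.range K, ∫ ω, S k ω ∂μ ≤
      ∑ k ∈ Finset.range K, r k * ∫ ω, A k ω ∂μ + ∫ ω, Y K ω ∂μ := fun K => by
    rw [← sub_le_iff_le_add', ← Finset.sum_sub_distrib]
    refine (Finset.sum_congr rfl fun k _ => ?_).trans_le (hqueue K).2
    rw [integral_sub (hSint k) ((hAint k).mul_const (r k)), integral_mul_const, mul_comm]
  have hYnn : ∀ K ω, 0 ≤ Y K ω := fun K ω => by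
    cases K with
    | zero => exact (hY0 ω).ge
    | succ K => exact (hYrec K ω).symm ▸ le_max_right _ _
  have hAsum : ∀ K, 0 ≤ ∑ k ∈ Finset.range K, ∫ ω, A k ω ∂μ := fun K =>
    Finset.sum_nonneg fun k _ => integral_nonneg (hAnn k)
  obtain ⟨c, hc, hcA⟩ := exists_pos_eventually_le_of_liminf_pos
    (fun K => div_nonneg (hAsum K) K.cast_nonneg) harr
  refine EReal.limsup_coe_le_of_eventually_le_add (by simpa using hmrs.div_const c) ?_
  filter_upwards [hcA, eventually_gt_atTop 0] with K hK hK0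
  have hKpos : (0 : ℝ) < K := Nat.cast_pos.mpr hK0
  rw [le_div_iff₀ hKpos] at hK
  calc _ ≤ _ := div_le_div_of_nonneg_right (hdrift K) (hAsum K)
    _ = _ := add_div _ _ _
    _ ≤ _ := by
      refine add_le_add_right ?_ _
      rw [div_div, mul_comm (K : ℝ)]
      exact div_le_div_of_nonneg_left (integral_nonneg (hYnn K)) (mul_pos hc hKpos) hK
end

section
/- Let Yᵢ : ℕ → ℝ for i = 1, …, N be nonnegative sequences with Yᵢ(0) = 0, let f : ℕ → ℝ satisfy 1 ≤ f(k) ≤ F for all k and some constant F, let pᵢ : ℕ → ℝ be nonnegative, let C ≥ 0, V > 0, and bᵢ ≥ 0 be constants. Suppose that for every k, (1/2)·∑ᵢ (Yᵢ(k+1)² − Yᵢ(k)²) + V·∑ᵢ pᵢ(k)·f(k) ≤ C + V·∑ᵢ bᵢ·f(k). Then for every K ≥ 1: (i) ∑ᵢ (∑_{k<K} pᵢ(k)·f(k)) / (∑_{k<K} f(k)) ≤ C/V + ∑ᵢ bᵢ, and (ii) ∑ᵢ Yᵢ(K)² ≤ 2·K·(C + V·F·∑ᵢ bᵢ). -/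
/-- The drift-plus-penalty inequality summed over the first `K` frames. -/
theorem drift_plus_penalty_telescope {ι : Type*} [Fintype ι] {Y p : ι → ℕ → ℝ}
    {f : ℕ → ℝ} {b : ι → ℝ} {C V : ℝ} (hY0 : ∀ i, Y i 0 = 0)
    (hdrift : ∀ k,
      (1 / 2) * (∑ i, (Y i (k + 1) ^ 2 - Y i k ^ 2)) + V * ∑ i, p i k * f k ≤
        C + V * ∑ i, b i * f k) (K : ℕ) :
    (1 / 2) * (∑ i, Y i K ^ 2) + V * ∑ i, ∑ k ∈ Finset.range K, p i k * f k ≤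
      K * C + V * ((∑ i, b i) * ∑ k ∈ Finset.range K, f k) := by
  induction K with
  | zero => simp [hY0]
  | succ K ih =>
    have h := hdrift K
    rw [Finset.sum_sub_distrib, ← Finset.sum_mul Finset.univ b] at h
    simp only [Finset.sum_range_succ, Finset.sum_add_distrib]
    push_cast
    linarith

/-- Deterministic core of the proof of Theorem 1 (inequalities (14)–(18)):
from the per-frame drift-plus-penalty bound one obtains (i) the frame-averaged
penalty bound with optimality gap `C/V` and (ii) the second-moment bound on the
virtual queues used for mean rate stability. -/
theorem drift_plus_penalty_core
    (N : ℕ) (Y : Fin N → ℕ → ℝ)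
    (hYnn : ∀ i k, 0 ≤ Y i k) (hY0 : ∀ i, Y i 0 = 0)
    (f : ℕ → ℝ) (F : ℝ) (hf : ∀ k, 1 ≤ f k ∧ f k ≤ F)
    (p : Fin N → ℕ → ℝ) (hp : ∀ i k, 0 ≤ p i k)
    (C V : ℝ) (hC : 0 ≤ C) (hV : 0 < V)
    (b : Fin N → ℝ) (hb : ∀ i, 0 ≤ b i)
    (hdrift : ∀ k,
      (1 / 2) * (∑ i, (Y i (k + 1) ^ 2 - Y i k ^ 2)) + V * ∑ i, p i k * f k ≤
        C + V * ∑ i, b i * f k) :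
    ∀ K : ℕ, 1 ≤ K →
      ((∑ i, (∑ k ∈ Finset.range K, p i k * f k) / (∑ k ∈ Finset.range K, f k)) ≤
          C / V + ∑ i, b i) ∧
      (∑ i, Y i K ^ 2) ≤ 2 * K * (C + V * F * ∑ i, b i) := by
  intro K hK
  have hsum := drift_plus_penalty_telescope hY0 hdrift K
  have hb_sum : 0 ≤ ∑ i, b i := Finset.sum_nonneg fun i _ => hb i
  have hS_ge : (K : ℝ) ≤ ∑ k ∈ Finset.range K, f k := by
    simpa using Finset.card_nsmul_le_sum (Finset.range K) f 1 fun k _ => (hf k).1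
  have hS_le : ∑ k ∈ Finset.range K, f k ≤ K * F := by
    simpa using Finset.sum_le_card_nsmul (Finset.range K) f F fun k _ => (hf k).2
  have hK_pos : (0 : ℝ) < K := by exact_mod_cast hK
  have hS_pos := hK_pos.trans_le hS_ge
  constructor
  · have hY_sum : 0 ≤ ∑ i, Y i K ^ 2 := Finset.sum_nonneg fun i _ => sq_nonneg _
    have hCS := mul_le_mul_of_nonneg_right hS_ge hC
    rw [← Finset.sum_div, div_le_iff₀ hS_pos, ← mul_le_mul_iff_right₀ hV]
    have hexpand : V * ((C / V + ∑ i, b i) * ∑ k ∈ Finset.range K, f k) =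
        (∑ k ∈ Finset.range K, f k) * C +
          V * ((∑ i, b i) * ∑ k ∈ Finset.range K, f k) := by
      field_simp
    linarith
  · have hpenalty : 0 ≤ V * ∑ i, ∑ k ∈ Finset.range K, p i k * f k :=
      mul_nonneg hV.le <| Finset.sum_nonneg fun i _ => Finset.sum_nonneg fun k _ =>
        mul_nonneg (hp i k) (zero_le_one.trans (hf k).1)
    have hcost := mul_le_mul_of_nonneg_left hS_le (mul_nonneg hV.le hb_sum)
    linarith
end

section
/- Let h : ℝ → ℝ be convex and continuous, let f : ℕ → ℝ satisfy f(k) ≥ 1 for all k, and let r : ℕ → ℝ. Define for K ≥ 1 the weighted averages R_K = (∑_{k<K} f(k)·r(k)) / (∑_{k<K} f(k)) and H_K = (∑_{k<K} f(k)·h(r(k))) / (∑_{k<K} f(k)). If R_K converges to a limit W̄ as K → ∞, then h(W̄) ≤ liminf_{K→∞} H_K. -/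
open Filter

/-- Lemma 7.6 of Neely (inequality (17)): if the frame-length-weighted running
averages `R_K` of the auxiliary variables converge to `W̄`, then the cost of the
limit is bounded by the liminf of the weighted averages of the costs:
`h(W̄) ≤ liminf H_K`. -/
theorem convex_cost_of_limit_le_liminf_weighted_cost
    (h : ℝ → ℝ) (hconv : ConvexOn ℝ Set.univ h) (hcont : Continuous h)
    (f : ℕ → ℝ) (hf : ∀ k, 1 ≤ f k)
    (r : ℕ → ℝ) (W : ℝ)
    (hR : Tendsto
      (fun K : ℕ =>
        (∑ k ∈ Finset.range K, f k * r k) / (∑ k ∈ Finset.range K, f k))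
      atTop (nhds W)) :
    (h W : EReal) ≤ liminf
      (fun K : ℕ =>
        (((∑ k ∈ Finset.range K, f k * h (r k)) /
          (∑ k ∈ Finset.range K, f k) : ℝ) : EReal)) atTop := by
  have hlim : Tendsto (fun K : ℕ =>
      ((h ((∑ k ∈ Finset.range K, f k * r k) / (∑ k ∈ Finset.range K, f k)) : ℝ) : EReal))
      atTop (nhds (h W : EReal)) :=
    (continuous_coe_real_ereal.tendsto _).comp ((hcont.tendsto W).comp hR)
  rw [← hlim.liminf_eq]
  refine liminf_le_liminf ?_
  filter_upwards [eventually_gt_atTop 0] with K hK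
  have hpos : ∀ k, 0 < f k := fun k => one_pos.trans_le (hf k)
  have hsum : 0 < ∑ k ∈ Finset.range K, f k :=
    Finset.sum_pos (fun k _ => hpos k) (Finset.nonempty_range_iff.mpr hK.ne')
  have jensen := hconv.map_centerMass_le (t := Finset.range K) (w := f) (p := r)
    (fun k _ => (hpos k).le) hsum (fun _ _ => Set.mem_univ _)
  simp only [Finset.centerMass, smul_eq_mul, Function.comp_apply, inv_mul_eq_div] at jensen
  exact EReal.coe_le_coe_iff.mpr jensen
end
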